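/- If s is a ℤ-linear automorphism of Pic that preserves the intersection form and maps the set {D0, D1, …, D12} bijectively onto itself, then s maps the sublattice ℤα1 + ℤα2 + ℤα3 onto itself. -/

import Mathlib

/-- The Picard lattice of the space of initial values of the HV equation:
the free ℤ-module of rank 16 with basis `H0, H1, E1, …, E14`. -/
abbrev Pic : Type := Fin 16 → ℤ

/-- The class `H0` (total transform of a line `x = const`). -/
def H0 : Pic := Pi.single 0 1

/-- The class `H1` (total transform of a line `y = const`). -/
def H1 : Pic := Pi.single 1 1

/-- The exceptional classes: `E k` is the paper's `E_{k+1}` for `k : Fin 14`. -/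
def E (k : Fin 14) : Pic := Pi.single k.succ.succ 1

/-- The intersection form: `H0·H1 = 1`, `H0·H0 = H1·H1 = 0`, `Ek·El = -δ`, `Hi·Ek = 0`. -/
def ip (u v : Pic) : ℤ :=
  u 0 * v 1 + u 1 * v 0 - ∑ k : Fin 14, u k.succ.succ * v k.succ.succ

/-- The canonical class `K = -2H0 - 2H1 + E1 + ⋯ + E14`. -/
def KX : Pic := (-2 : ℤ) • H0 + (-2 : ℤ) • H1 + ∑ k : Fin 14, E k

/-- The classes `D0, …, D12` of the irreducible components of `-K`. -/
def D : Fin 13 → Pic :=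
  ![E 0 - E 1, E 1 - E 2, E 2 - E 3,
    E 4 - E 5, E 5 - E 6, E 6 - E 7,
    E 8 - E 9, E 10 - E 11, E 11 - E 12, E 12 - E 13,
    H0 - E 0 - E 1 - E 8, H1 - E 4 - E 5 - E 8, E 9 - E 10 - E 11]

/-- The root basis `α1, α2, α3` of the orthogonal complement of the `D`'s. -/
def α : Fin 3 → Pic :=
  ![(2 : ℤ) • H1 - E 0 - E 1 - E 2 - E 3,
    (2 : ℤ) • H0 - E 4 - E 5 - E 6 - E 7,
    (2 : ℤ) • H0 + (2 : ℤ) • H1 - (2 : ℤ) • E 8 - (2 : ℤ) • E 9 - E 10 - E 11 - E 12 - E 13]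

/-- The ℤ-linear map sending the `j`-th basis vector to `f j`. -/
def ofImages (f : Fin 16 → Pic) : Pic →ₗ[ℤ] Pic :=
  Matrix.toLin' (Matrix.of fun i j => f j i)

/-- The generator `w1`. -/
def w1 : Pic →ₗ[ℤ] Pic := ofImages
  ![H0 + (2 : ℤ) • H1 - E 0 - E 1 - E 2 - E 3, H1,
    H1 - E 3, H1 - E 2, H1 - E 1, H1 - E 0,
    E 4, E 5, E 6, E 7, E 8, E 9, E 10, E 11, E 12, E 13]

/-- The generator `w2`. -/
def w2 : Pic →ₗ[ℤ] Pic := ofImages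
  ![H0, (2 : ℤ) • H0 + H1 - E 4 - E 5 - E 6 - E 7,
    E 0, E 1, E 2, E 3,
    H0 - E 7, H0 - E 6, H0 - E 5, H0 - E 4,
    E 8, E 9, E 10, E 11, E 12, E 13]

/-- The generator `w3`. -/
def w3 : Pic →ₗ[ℤ] Pic := ofImages
  ![H0 + α 2, H1 + α 2,
    E 0, E 1, E 2, E 3, E 4, E 5, E 6, E 7,
    E 8 + α 2, E 9 + α 2,
    E 10 + (H0 + H1 - E 8 - E 9 - E 10 - E 13),
    E 11 + (H0 + H1 - E 8 - E 9 - E 11 - E 12),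
    E 12 + (H0 + H1 - E 8 - E 9 - E 11 - E 12),
    E 13 + (H0 + H1 - E 8 - E 9 - E 10 - E 13)]

/-- The generator `σ12`. -/
def s12 : Pic →ₗ[ℤ] Pic := ofImages
  ![H1, H0, E 4, E 5, E 6, E 7, E 0, E 1, E 2, E 3,
    E 8, E 9, E 10, E 11, E 12, E 13]

/-- The generator `σ13`. -/
def s13 : Pic →ₗ[ℤ] Pic := ofImages
  ![H0, H0 + H1 - E 8 - E 9,
    E 10, E 11, E 12, E 13,
    E 4, E 5, E 6, E 7,
    H0 - E 9, H0 - E 8,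
    E 0, E 1, E 2, E 3]

/-- The action `φ` of the Hietarinta–Viallet equation on the Picard lattice. -/
def phiHV : Pic →ₗ[ℤ] Pic := ofImages
  ![(3 : ℤ) • H0 + H1 - E 4 - E 5 - E 6 - E 7 - E 8 - E 9, H0,
    H0 - E 7, H0 - E 6, H0 - E 5, H0 - E 4,
    E 10, E 11, E 12, E 13,
    H0 - E 9, H0 - E 8,
    E 0, E 1, E 2, E 3]

lemma ip_sub_left (u v w : Pic) : ip (u - v) w = ip u w - ip v w := by
  simp only [ip, Pi.sub_apply, sub_mul, Finset.sum_sub_distrib]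
  ring

lemma ip_H0_left (u : Pic) : ip H0 u = u 1 := by
  simp [ip, H0]

lemma ip_H1_left (u : Pic) : ip H1 u = u 0 := by
  simp [ip, H1, Fin.succ_succ_ne_one]

lemma ip_E_left (k : Fin 14) (u : Pic) : ip (E k) u = -u k.succ.succ := by
  simp [ip, E, Pi.single_apply, (Fin.succ_ne_zero _).symm, (Fin.succ_succ_ne_one _).symm]

/-- Orthogonality to all the `D`'s, in coordinates. -/
lemma forall_ip_D_eq_zero_iff (u : Pic) :
    (∀ i, ip (D i) u = 0) ↔
      (u 2 = u 3 ∧ u 3 = u 4 ∧ u 4 = u 5) ∧ (u 6 = u 7 ∧ u 7 = u 8 ∧ u 8 = u 9) ∧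
      u 10 = u 11 ∧ (u 12 = u 13 ∧ u 13 = u 14 ∧ u 14 = u 15) ∧
      u 1 + u 2 + u 3 + u 10 = 0 ∧ u 0 + u 6 + u 7 + u 10 = 0 ∧ u 11 = u 12 + u 13 := by
  simp [Fin.forall_fin_succ, D, ip_sub_left, ip_H0_left, ip_H1_left, ip_E_left]
  omega

/-- The span of the `α`'s is exactly the orthogonal complement of the `D`'s. -/
lemma mem_span_alpha_iff (u : Pic) :
    u ∈ Submodule.span ℤ ({α 0, α 1, α 2} : Set Pic) ↔ ∀ i, ip (D i) u = 0 := by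
  rw [Submodule.mem_span_triple, forall_ip_D_eq_zero_iff]
  constructor
  · rintro ⟨a, b, c, rfl⟩
    simp [α, H0, H1, E]
    omega
  · intro h
    refine ⟨-u 2, -u 6, -u 12, ?_⟩
    ext j
    fin_cases j <;> simp [α, H0, H1, E] <;> omega

/-- Any ℤ-linear automorphism of `Pic` preserving the intersection form and permuting
the set `{D0, …, D12}` maps the sublattice `ℤα1 + ℤα2 + ℤα3` onto itself. -/
theorem span_alpha_invariant (s : Pic ≃ₗ[ℤ] Pic)
    (hform : ∀ u v : Pic, ip (s u) (s v) = ip u v)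
    (hD : Set.BijOn s (Set.range D) (Set.range D)) :
    Submodule.map (s : Pic →ₗ[ℤ] Pic) (Submodule.span ℤ ({α 0, α 1, α 2} : Set Pic))
      = Submodule.span ℤ ({α 0, α 1, α 2} : Set Pic) := by
  ext v
  rw [Submodule.mem_map]
  constructor
  · rintro ⟨u, hu, rfl⟩
    rw [mem_span_alpha_iff] at hu ⊢
    intro i
    obtain ⟨_, ⟨j, rfl⟩, hj⟩ := hD.surjOn ⟨i, rfl⟩
    rw [← hj]
    exact (hform _ _).trans (hu j)
  · intro hv
    refine ⟨s.symm v, ?_, s.apply_symm_apply v⟩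
    rw [mem_span_alpha_iff] at hv ⊢
    intro j
    obtain ⟨i, hi⟩ := hD.mapsTo ⟨j, rfl⟩
    rw [← hform, s.apply_symm_apply, ← hi]
    exact hv i
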